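/- Let 𝒜 = (I, (A_a)_{a∈Σ}, F) be a minimal uniformly convergent WFA, so that A_w = lim_{k→∞} A_{pref_k(w)} exists for every w ∈ Σ^ω. Then for every w ∈ Σ^ω and every u ∈ Σ*, A_w A_u = A_w. -/

import Mathlib

open Filter Topology Matrix

/-- The prefix of length `k` of an infinite word `w`. -/
def pref {A : Type*} (w : ℕ → A) (k : ℕ) : List A := (List.range k).map w

/-- The product `A_{v₁} ⋯ A_{v_k}` of matrices along a finite word `v`. -/
def wordProd {A : Type*} {n : ℕ} (M : A → Matrix (Fin n) (Fin n) ℝ) (v : List A) :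
    Matrix (Fin n) (Fin n) ℝ := (v.map M).prod

/-- The word function of the WFA `(I, M, F)`: `v ↦ I A_v F`. -/
def wfaWord {A : Type*} {n : ℕ} (I : Fin n → ℝ) (M : A → Matrix (Fin n) (Fin n) ℝ)
    (F : Fin n → ℝ) (v : List A) : ℝ := I ⬝ᵥ (wordProd M v) *ᵥ F

/-- The WFA with `n` states is left minimal: the row vectors `I A_u` span `ℝⁿ`. -/
def LeftMinimal {A : Type*} {n : ℕ} (I : Fin n → ℝ)
    (M : A → Matrix (Fin n) (Fin n) ℝ) : Prop :=
  Submodule.span ℝ {x : Fin n → ℝ | ∃ u : List A, x = I ᵥ* (wordProd M u)} = ⊤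

/-- The WFA with `n` states is right minimal: the column vectors `A_u F` span `ℝⁿ`. -/
def RightMinimal {A : Type*} {n : ℕ} (M : A → Matrix (Fin n) (Fin n) ℝ)
    (F : Fin n → ℝ) : Prop :=
  Submodule.span ℝ {x : Fin n → ℝ | ∃ u : List A, x = (wordProd M u) *ᵥ F} = ⊤

/-- A word function `F : Σ* → ℝ` is uniformly convergent with ω-function `f`. -/
def UnifConv {A : Type*} (F : List A → ℝ) (f : (ℕ → A) → ℝ) : Prop :=
  (∀ w : ℕ → A, Tendsto (fun k => F (pref w k)) atTop (𝓝 (f w))) ∧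
  ∀ ε > (0 : ℝ), ∃ k₀ : ℕ, ∀ w : ℕ → A, ∀ k > k₀, |F (pref w k) - f w| < ε

theorem wordProd_append {A : Type*} {n : ℕ} (M : A → Matrix (Fin n) (Fin n) ℝ) (u v : List A) :
    wordProd M (u ++ v) = wordProd M u * wordProd M v := by
  simp [wordProd]

theorem length_pref {A : Type*} (w : ℕ → A) (k : ℕ) : (pref w k).length = k := by
  simp [pref]

theorem pref_getD {A : Type*} (l : List A) (a : A) {k : ℕ} (hk : k ≤ l.length) :
    pref (fun i => l.getD i a) k = l.take k := by
  refine List.ext_getElem (by simp [pref, hk]) fun i h₁ h₂ => ?_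
  have hi : i < l.length := (lt_min_iff.1 (List.length_take ▸ h₂)).2
  simp [pref, hi]

/-- Extending a long word changes the value of a uniformly convergent word function only
slightly. -/
theorem UnifConv.exists_abs_append_sub_lt {A : Type*} [Nonempty A] {G : List A → ℝ}
    {f : (ℕ → A) → ℝ} (hG : UnifConv G f) {ε : ℝ} (hε : 0 < ε) :
    ∃ k₀ : ℕ, ∀ p x : List A, k₀ < p.length → |G (p ++ x) - G p| < ε := by
  obtain ⟨k₀, hk₀⟩ := hG.2 (ε / 2) (half_pos hε)
  refine ⟨k₀, fun p x hp => ?_⟩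
  let w : ℕ → A := fun i => (p ++ x).getD i (Classical.arbitrary A)
  have h₁ : pref w p.length = p := by
    rw [pref_getD _ _ (by simp), List.take_left]
  have h₂ : pref w (p ++ x).length = p ++ x := by
    rw [pref_getD _ _ le_rfl, List.take_length]
  have h₃ := hk₀ w p.length hp
  have h₄ := hk₀ w (p ++ x).length (by rw [List.length_append]; omega)
  rw [h₁] at h₃
  rw [h₂] at h₄
  rw [abs_lt] at *
  constructor <;> linarith

theorem UnifConv.tendsto_append_sub {A : Type*} [Nonempty A] {G : List A → ℝ}
    {f : (ℕ → A) → ℝ} (hG : UnifConv G f) (w : ℕ → A) (v x : List A) :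
    Tendsto (fun k => G (v ++ pref w k ++ x) - G (v ++ pref w k)) atTop (𝓝 0) := by
  rw [Metric.tendsto_atTop]
  intro ε hε
  obtain ⟨k₀, hk₀⟩ := hG.exists_abs_append_sub_lt hε
  refine ⟨k₀ + 1, fun k hk => ?_⟩
  rw [Real.dist_eq, sub_zero]
  exact hk₀ _ _ (by rw [List.length_append, length_pref]; omega)

/-- For a minimal automaton, a matrix is determined by its pairings with the reachable row and
column vectors. -/
theorem matrix_eq_of_minimal {A : Type*} {n : ℕ} {I : Fin n → ℝ}
    {M : A → Matrix (Fin n) (Fin n) ℝ} {F : Fin n → ℝ}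
    (hl : LeftMinimal I M) (hr : RightMinimal M F) {N P : Matrix (Fin n) (Fin n) ℝ}
    (h : ∀ v x : List A, I ⬝ᵥ (wordProd M v * N * wordProd M x) *ᵥ F =
      I ⬝ᵥ (wordProd M v * P * wordProd M x) *ᵥ F) : N = P := by
  have hcol : ∀ x : List A, N *ᵥ (wordProd M x *ᵥ F) = P *ᵥ (wordProd M x *ᵥ F) := by
    intro x
    refine dotProduct_eq _ _ fun y => ?_
    rw [dotProduct_comm, dotProduct_comm _ y]
    have hy : y ∈ Submodule.span ℝ {x : Fin n → ℝ | ∃ u : List A, x = I ᵥ* (wordProd M u)} :=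
      hl ▸ Submodule.mem_top
    induction hy using Submodule.span_induction with
    | mem y hy =>
      obtain ⟨v, rfl⟩ := hy
      simpa only [← dotProduct_mulVec, mulVec_mulVec, Matrix.mul_assoc] using h v x
    | zero => simp
    | add y z _ _ hy hz => rw [add_dotProduct, add_dotProduct, hy, hz]
    | smul c y _ hy => rw [smul_dotProduct, smul_dotProduct, hy]
  refine Matrix.toLin'.injective (LinearMap.ext_on hr ?_)
  rintro _ ⟨x, rfl⟩
  simpa only [toLin'_apply] using hcol x

/-- Reading a finite word after the limit matrix does not change the value. -/
theorem dotProduct_limit_mul_wordProd {A : Type*} [Nonempty A] {n : ℕ} {I : Fin n → ℝ}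
    {M : A → Matrix (Fin n) (Fin n) ℝ} {F : Fin n → ℝ} {f : (ℕ → A) → ℝ}
    (hA : UnifConv (wfaWord I M F) f) {w : ℕ → A} {L : Matrix (Fin n) (Fin n) ℝ}
    (hL : Tendsto (fun k => wordProd M (pref w k)) atTop (𝓝 L)) (v x : List A) :
    I ⬝ᵥ (wordProd M v * L * wordProd M x) *ᵥ F = I ⬝ᵥ (wordProd M v * L) *ᵥ F := by
  have hcont : Continuous fun N : Matrix (Fin n) (Fin n) ℝ =>
      I ⬝ᵥ (wordProd M v * N * wordProd M x) *ᵥ F - I ⬝ᵥ (wordProd M v * N) *ᵥ F := by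
    fun_prop
  have hlim := (hcont.tendsto L).comp hL
  have hzero := hA.tendsto_append_sub w v x
  simp only [wfaWord, wordProd_append] at hzero
  exact sub_eq_zero.1 (tendsto_nhds_unique hlim hzero)

/-- Let `𝒜 = (I, (A_a), F)` be a minimal, uniformly convergent WFA, and suppose the limits
`A_w = lim_k A_{pref_k(w)}` exist.  Then `A_w A_u = A_w` for every `w ∈ Σ^ω` and `u ∈ Σ*`. -/
theorem limit_matrix_absorbs
    {A : Type*} [Fintype A] [Nonempty A]
    {n : ℕ} (I : Fin n → ℝ) (M : A → Matrix (Fin n) (Fin n) ℝ) (F : Fin n → ℝ)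
    (hl : LeftMinimal I M) (hr : RightMinimal M F)
    (f : (ℕ → A) → ℝ) (hA : UnifConv (wfaWord I M F) f)
    (Aω : (ℕ → A) → Matrix (Fin n) (Fin n) ℝ)
    (hAω : ∀ w : ℕ → A, Tendsto (fun k => wordProd M (pref w k)) atTop (𝓝 (Aω w)))
    (w : ℕ → A) (u : List A) :
    Aω w * wordProd M u = Aω w := by
  refine matrix_eq_of_minimal hl hr fun v x => ?_
  rw [dotProduct_limit_mul_wordProd hA (hAω w), ← Matrix.mul_assoc, Matrix.mul_assoc _ _ (wordProd M x),
    ← wordProd_append, dotProduct_limit_mul_wordProd hA (hAω w)]
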